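/- Let (𝒵, ρ) be a pseudometric space, let d ≥ 1, and let f : (Fin d → 𝒵) → ℝ satisfy the local oscillation bounds: δ : Fin d → ℝ is such that for every j and all z, z' : Fin d → 𝒵 with z_k = z'_k for all k ≠ j, |f(z) − f(z')| ≤ δ_j · ρ(z_j, z'_j). Let ν be a probability measure on a measurable space Ω and let U, V : Ω → (Fin d → 𝒵) be maps such that f ∘ U and f ∘ V are ν-integrable and, for each j, the function τ ↦ ρ((U τ)_j, (V τ)_j) is ν-integrable. Then |∫ f(U τ) dν(τ) − ∫ f(V τ) dν(τ)| ≤ Σ_j δ_j · ∫ ρ((U τ)_j, (V τ)_j) dν(τ). -/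

import Mathlib

open MeasureTheory

/-- A function with coordinatewise oscillation bounds `δ` varies by at most the `δ`-weighted sum of
the coordinate distances when the coordinates in `s` are replaced. -/
theorem abs_sub_piecewise_le_sum_mul_dist {ι X : Type*} [DecidableEq ι] [PseudoMetricSpace X]
    {f : (ι → X) → ℝ} {δ : ι → ℝ}
    (hosc : ∀ j, ∀ z z' : ι → X, (∀ k, k ≠ j → z k = z' k) →
      |f z - f z'| ≤ δ j * dist (z j) (z' j))
    (z w : ι → X) (s : Finset ι) :
    |f z - f (s.piecewise w z)| ≤ ∑ j ∈ s, δ j * dist (z j) (w j) := by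
  induction s using Finset.induction_on with
  | empty => simp
  | insert j s hj ih =>
    rw [Finset.sum_insert hj, Finset.piecewise_insert]
    have h := hosc j (s.piecewise w z) (Function.update (s.piecewise w z) j (w j))
      fun k hk => (Function.update_of_ne hk _ _).symm
    rw [Function.update_self, Finset.piecewise_eq_of_notMem _ _ _ hj] at h
    linarith [abs_sub_le (f z) (f (s.piecewise w z))
      (f (Function.update (s.piecewise w z) j (w j)))]

/-- **Coupling estimate** (core of the proof of Proposition 4.4): if `f` has local oscillations
bounded by `δ_j` in each coordinate, then for maps `U, V : Ω → (Fin d → 𝒵)` the difference of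
expectations of `f ∘ U` and `f ∘ V` under `ν` is bounded by the weighted sum of expected
coordinatewise distances. -/
theorem coupling_oscillation_estimate {𝒵 : Type*} [PseudoMetricSpace 𝒵]
    {Ω : Type*} [MeasurableSpace Ω] (ν : Measure Ω) [IsProbabilityMeasure ν]
    (d : ℕ) (hd : 1 ≤ d) (f : (Fin d → 𝒵) → ℝ) (δ : Fin d → ℝ)
    (hosc : ∀ j : Fin d, ∀ z z' : Fin d → 𝒵, (∀ k : Fin d, k ≠ j → z k = z' k) →
      |f z - f z'| ≤ δ j * dist (z j) (z' j))
    (U V : Ω → Fin d → 𝒵)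
    (hU : Integrable (fun τ => f (U τ)) ν) (hV : Integrable (fun τ => f (V τ)) ν)
    (hρ : ∀ j : Fin d, Integrable (fun τ => dist (U τ j) (V τ j)) ν) :
    |(∫ τ, f (U τ) ∂ν) - ∫ τ, f (V τ) ∂ν| ≤
      ∑ j : Fin d, δ j * ∫ τ, dist (U τ j) (V τ j) ∂ν := by
  have hbound (τ : Ω) : |f (U τ) - f (V τ)| ≤ ∑ j, δ j * dist (U τ j) (V τ j) := by
    simpa using abs_sub_piecewise_le_sum_mul_dist hosc (U τ) (V τ) Finset.univ
  calc |(∫ τ, f (U τ) ∂ν) - ∫ τ, f (V τ) ∂ν|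
      = |∫ τ, (f (U τ) - f (V τ)) ∂ν| := by rw [integral_sub hU hV]
    _ ≤ ∫ τ, |f (U τ) - f (V τ)| ∂ν := abs_integral_le_integral_abs
    _ ≤ ∫ τ, ∑ j, δ j * dist (U τ j) (V τ j) ∂ν :=
        integral_mono (hU.sub hV).abs
          (integrable_finsetSum _ fun j _ => (hρ j).const_mul (δ j)) hbound
    _ = ∑ j, δ j * ∫ τ, dist (U τ j) (V τ j) ∂ν := by
        rw [integral_finsetSum _ fun j _ => (hρ j).const_mul (δ j)]
        simp only [integral_const_mul]
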